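/- arXiv:2009.11580 — 7 statements merged into one kernel-verified Lean document; each statement's English description precedes it below -/
import Mathlib

section
/- In the Wheatstone routing game with middle-edge cost c3(x) = εx + 5 and 0 < ε ≤ 1, for every demand d ≥ 0, every Wardrop equilibrium (y1, y2, y3) satisfies y3 = 0; that is, the route through the middle edge carries no flow. -/
/-- Cost of route `r1 = (e1, e4)`: `c1(y1+y3) + c4(y1)` with
`c1(x) = x`, `c4(x) = 1 + ε x`. -/
noncomputable def C1 (ε y1 y2 y3 : ℝ) : ℝ := (y1 + y3) + (1 + ε * y1)

/-- Cost of route `r2 = (e2, e5)`: `c2(y2) + c5(y2+y3)` with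
`c2(x) = 1 + ε x`, `c5(x) = x`. -/
noncomputable def C2 (ε y1 y2 y3 : ℝ) : ℝ := (1 + ε * y2) + (y2 + y3)

/-- Cost of route `r3 = (e1, e3, e5)`: `c1(y1+y3) + c3(y3) + c5(y2+y3)` with
`c1(x) = x`, `c5(x) = x` and a given middle-edge cost `c3`. -/
noncomputable def C3 (c3 : ℝ → ℝ) (ε y1 y2 y3 : ℝ) : ℝ :=
  (y1 + y3) + c3 y3 + (y2 + y3)

/-- Wardrop equilibrium of the Wheatstone routing game with middle-edge cost
`c3`, parameter `ε` and demand `d`: the flow `(y1, y2, y3)` is feasible and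
every route with positive flow has minimal cost. -/
def IsWheatstoneEq (c3 : ℝ → ℝ) (ε d y1 y2 y3 : ℝ) : Prop :=
  0 ≤ y1 ∧ 0 ≤ y2 ∧ 0 ≤ y3 ∧ y1 + y2 + y3 = d ∧
  (0 < y1 → C1 ε y1 y2 y3 ≤ C2 ε y1 y2 y3 ∧ C1 ε y1 y2 y3 ≤ C3 c3 ε y1 y2 y3) ∧
  (0 < y2 → C2 ε y1 y2 y3 ≤ C1 ε y1 y2 y3 ∧ C2 ε y1 y2 y3 ≤ C3 c3 ε y1 y2 y3) ∧
  (0 < y3 → C3 c3 ε y1 y2 y3 ≤ C1 ε y1 y2 y3 ∧ C3 c3 ε y1 y2 y3 ≤ C2 ε y1 y2 y3)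

/-- With middle-edge cost `c3(x) = ε x + 5` and `0 < ε ≤ 1`, for every demand
`d ≥ 0` every Wardrop equilibrium of the Wheatstone game has no flow on the
middle route. -/
theorem stmt2 (ε d y1 y2 y3 : ℝ) (hε0 : 0 < ε) (hε1 : ε ≤ 1) (hd : 0 ≤ d)
    (h : IsWheatstoneEq (fun x => ε * x + 5) ε d y1 y2 y3) :
    y3 = 0 := by
  obtain ⟨hy1, hy2, hy3, -, -, -, h3⟩ := h
  by_contra hne
  obtain ⟨h31, h32⟩ := h3 (lt_of_le_of_ne hy3 (Ne.symm hne))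
  simp only [C1, C2, C3] at h31 h32
  have hεy1 : ε * y1 ≤ y1 := mul_le_of_le_one_left hy1 hε1
  have hεy2 : ε * y2 ≤ y2 := mul_le_of_le_one_left hy2 hε1
  have hεy3 : 0 ≤ ε * y3 := mul_nonneg hε0.le hy3
  linarith
end

section
/- In the Wheatstone routing game with middle-edge cost c3(x) = εx + 5 and 0 < ε < 1, every Wardrop equilibrium (y1, y2, y3) for any demand d ≥ 0 satisfies y1 = y2; that is, the two outer routes carry equal flow. -/
/-- With middle-edge cost `c3(x) = ε x + 5` and `0 < ε < 1`, every Wardrop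
equilibrium of the Wheatstone game for any demand `d ≥ 0` has equal flows on
the two outer routes. -/
theorem stmt3 (ε d y1 y2 y3 : ℝ) (hε0 : 0 < ε) (hε1 : ε < 1) (hd : 0 ≤ d)
    (h : IsWheatstoneEq (fun x => ε * x + 5) ε d y1 y2 y3) :
    y1 = y2 := by
  obtain ⟨hy1, hy2, -, -, h1, h2, -⟩ := h
  simp only [C1, C2] at h1 h2
  rcases lt_trichotomy y1 y2 with hlt | heq | hgt
  · nlinarith [(h2 (hy1.trans_lt hlt)).1]
  · exact heq
  · nlinarith [(h1 (hy2.trans_lt hgt)).1]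
end

section
/- In the Wheatstone routing game under the good state, i.e. with middle-edge cost c3(x) = εx and 0 < ε < 1, for every demand d > 2/(1-ε), every Wardrop equilibrium (y1, y2, y3) satisfies y3 = 0; that is, for high demand the middle route carries no flow even under complete information. -/
/-- With middle-edge cost `c3(x) = ε x` and `0 < ε < 1` (the good state), for
every demand `d > 2/(1-ε)` every Wardrop equilibrium of the Wheatstone game
has no flow on the middle route. -/
theorem stmt6 (ε d y1 y2 y3 : ℝ) (hε0 : 0 < ε) (hε1 : ε < 1)
    (hd : 2 / (1 - ε) < d)
    (h : IsWheatstoneEq (fun x => ε * x) ε d y1 y2 y3) :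
    y3 = 0 := by
  obtain ⟨-, -, h3, hsum, -, -, hmid⟩ := h
  by_contra hne
  have hpos : 0 < y3 := lt_of_le_of_ne h3 (Ne.symm hne)
  obtain ⟨h31, h32⟩ := hmid hpos
  simp only [C1, C2, C3] at h31 h32
  rw [div_lt_iff₀ (sub_pos.mpr hε1), ← hsum] at hd
  linarith [mul_pos hε0 hpos]
end

section
/- Consider a routing game on n parallel links with continuous, strictly increasing cost functions c_1, …, c_n. If 0 ≤ d ≤ d', y is a Wardrop equilibrium for demand d, and y' is a Wardrop equilibrium for demand d', then y_i ≤ y'_i for every link i; that is, equilibrium loads are nondecreasing functions of the demand. -/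
/-- A Wardrop equilibrium of the parallel-links routing game with `n` links,
cost functions `c` and demand `d`: the flow `y` is nonnegative, routes the
demand, and every link with positive flow has minimal cost. -/
def IsWardrop (n : ℕ) (c : Fin n → ℝ → ℝ) (d : ℝ) (y : Fin n → ℝ) : Prop :=
  (∀ i, 0 ≤ y i) ∧ (∑ i, y i = d) ∧
    ∀ i j, 0 < y i → c i (y i) ≤ c j (y j)

/-- For continuous, strictly increasing cost functions, equilibrium loads on a
parallel-links network are nondecreasing functions of the demand. -/
theorem stmt12 {n : ℕ} (c : Fin n → ℝ → ℝ)
    (hcont : ∀ i, ContinuousOn (c i) (Set.Ici 0))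
    (hmono : ∀ i, StrictMonoOn (c i) (Set.Ici 0))
    (d d' : ℝ) (hd : 0 ≤ d) (hdd' : d ≤ d') (y y' : Fin n → ℝ)
    (hy : IsWardrop n c d y) (hy' : IsWardrop n c d' y') :
    ∀ i, y i ≤ y' i := by
  obtain ⟨hnonneg, hsum, hmin⟩ := hy
  obtain ⟨hnonneg', hsum', hmin'⟩ := hy'
  intro i
  by_contra! hi
  obtain ⟨j, hj⟩ : ∃ j, y j < y' j := by
    by_contra! h
    have hlt : ∑ k, y' k < ∑ k, y k :=
      Finset.sum_lt_sum (fun k _ => h k) ⟨i, Finset.mem_univ i, hi⟩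
    linarith
  have hi_lt : c i (y' i) < c i (y i) := hmono i (hnonneg' i) (hnonneg i) hi
  have hj_lt : c j (y j) < c j (y' j) := hmono j (hnonneg j) (hnonneg' j) hj
  have hij : c i (y i) ≤ c j (y j) := hmin i j ((hnonneg' i).trans_lt hi)
  have hji : c j (y' j) ≤ c i (y' i) := hmin' j i ((hnonneg j).trans_lt hj)
  linarith
end

section
/- Consider a routing game on n parallel links with continuous, strictly increasing cost functions c_1, …, c_n and demand d ≥ 0, and define the Beckmann potential Φ(y) = Σ_{i=1}^n ∫_0^{y_i} c_i(s) ds on the set of feasible flows. A feasible flow y is a Wardrop equilibrium if and only if y minimizes Φ over the set of feasible flows for demand d. -/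
open intervalIntegral in
/-- The tangent-line inequality for the primitive of a monotone function. -/
theorem MonotoneOn.sub_mul_le_integral_sub {f : ℝ → ℝ} (hf : MonotoneOn f (Set.Ici 0))
    {a b : ℝ} (ha : 0 ≤ a) (hb : 0 ≤ b) :
    (b - a) * f a ≤ (∫ s in (0 : ℝ)..b, f s) - ∫ s in (0 : ℝ)..a, f s := by
  have hint : ∀ u v : ℝ, 0 ≤ u → 0 ≤ v → IntervalIntegrable f MeasureTheory.volume u v :=
    fun u v hu hv => (hf.mono fun x hx => (le_min hu hv).trans hx.1).intervalIntegrable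
  rw [integral_interval_sub_left (hint 0 b le_rfl hb) (hint 0 a le_rfl ha)]
  rcases le_total a b with hab | hab
  · have h := integral_mono_on hab intervalIntegrable_const (hint a b ha hb)
      fun x hx => hf ha (ha.trans hx.1) hx.1
    simpa using h
  · have h := integral_mono_on hab (hint b a hb ha) intervalIntegrable_const
      fun x hx => hf (hb.trans hx.1) ha hx.2
    rw [integral_symm b a]
    simp only [integral_const, smul_eq_mul] at h
    linarith

/-- The variational inequality satisfied by a Wardrop equilibrium. -/
theorem IsWardrop.sum_sub_mul_nonneg {n : ℕ} {c : Fin n → ℝ → ℝ} {d : ℝ} {y z : Fin n → ℝ}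
    (hy : IsWardrop n c d y) (hz0 : ∀ i, 0 ≤ z i) (hzsum : ∑ i, z i = d) :
    0 ≤ ∑ i, (z i - y i) * c i (y i) := by
  obtain ⟨-, hysum, hle⟩ := hy
  rcases isEmpty_or_nonempty (Fin n) with _ | _
  · simp
  obtain ⟨m, hm⟩ := Finite.exists_min fun i => c i (y i)
  calc (0 : ℝ) = ∑ i, (z i - y i) * c m (y m) := by
        rw [← Finset.sum_mul, Finset.sum_sub_distrib, hzsum, hysum, sub_self, zero_mul]
    _ ≤ ∑ i, (z i - y i) * c i (y i) := by
        refine Finset.sum_le_sum fun i _ => ?_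
        by_cases hi : 0 < y i
        · rw [le_antisymm (hle i m hi) (hm i)]
        · exact mul_le_mul_of_nonneg_left (hm i) (by linarith [hz0 i])

/-- At a minimizer of the potential, shifting flow `ε` from link `i` to link `j` makes
link `j` at least as costly as link `i`. -/
theorem cost_le_cost_of_shift {n : ℕ} {c : Fin n → ℝ → ℝ}
    (hmono : ∀ i, MonotoneOn (c i) (Set.Ici 0)) {d : ℝ} {y : Fin n → ℝ}
    (hy0 : ∀ i, 0 ≤ y i) (hysum : ∑ i, y i = d)
    (hmin : ∀ z : Fin n → ℝ, (∀ i, 0 ≤ z i) → ∑ i, z i = d →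
      (∑ i, ∫ s in (0 : ℝ)..(y i), c i s) ≤ ∑ i, ∫ s in (0 : ℝ)..(z i), c i s)
    {i j : Fin n} (hij : i ≠ j) {ε : ℝ} (hε : 0 < ε) (hεy : ε ≤ y i) :
    c i (y i - ε) ≤ c j (y j + ε) := by
  set z : Fin n → ℝ := fun k => y k + ((if k = j then ε else 0) - if k = i then ε else 0)
    with hz
  have hz0 : ∀ k, 0 ≤ z k := by
    intro k
    simp only [hz]
    have := hy0 k
    split_ifs with h1 h2 h2 <;> subst_vars <;> linarith
  have hzsum : ∑ k, z k = d := by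
    simp [hz, Finset.sum_add_distrib, Finset.sum_sub_distrib, hysum]
  have hbound : ∑ k, (y k - z k) * c k (z k) ≤ 0 := by
    refine (Finset.sum_le_sum fun k _ =>
      (hmono k).sub_mul_le_integral_sub (hz0 k) (hy0 k)).trans ?_
    rw [Finset.sum_sub_distrib]
    exact sub_nonpos.2 (hmin z hz0 hzsum)
  have hsum : ∑ k, (y k - z k) * c k (z k) = ε * c i (z i) - ε * c j (z j) := by
    have hdiff : ∀ k, y k - z k = (if k = i then ε else 0) - if k = j then ε else 0 := by
      intro k
      simp only [hz]
      ring
    simp only [hdiff, sub_mul, Finset.sum_sub_distrib, ite_mul, zero_mul, Finset.sum_ite_eq',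
      Finset.mem_univ, if_true]
  have hzi : z i = y i - ε := by simp [hz, hij, sub_eq_add_neg]
  have hzj : z j = y j + ε := by simp [hz, hij.symm]
  rw [hsum, hzi, hzj, sub_nonpos] at hbound
  exact le_of_mul_le_mul_left hbound hε

open Filter Topology in
/-- Beckmann potential characterization: a feasible flow on a parallel-links
network is a Wardrop equilibrium if and only if it minimizes the potential
`Φ(y) = Σ_i ∫_0^{y_i} c_i(s) ds` over feasible flows. -/
theorem stmt14 {n : ℕ} (c : Fin n → ℝ → ℝ)
    (hcont : ∀ i, ContinuousOn (c i) (Set.Ici 0))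
    (hmono : ∀ i, StrictMonoOn (c i) (Set.Ici 0))
    (d : ℝ) (hd : 0 ≤ d) (y : Fin n → ℝ)
    (hy0 : ∀ i, 0 ≤ y i) (hysum : ∑ i, y i = d) :
    IsWardrop n c d y ↔
      ∀ z : Fin n → ℝ, (∀ i, 0 ≤ z i) → ∑ i, z i = d →
        (∑ i, ∫ s in (0:ℝ)..(y i), c i s) ≤ ∑ i, ∫ s in (0:ℝ)..(z i), c i s := by
  refine ⟨fun hw z hz0 hzsum => ?_, fun hmin => ⟨hy0, hysum, fun i j hi => ?_⟩⟩
  · rw [← sub_nonneg, ← Finset.sum_sub_distrib]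
    exact (hw.sum_sub_mul_nonneg hz0 hzsum).trans (Finset.sum_le_sum fun i _ =>
      (hmono i).monotoneOn.sub_mul_le_integral_sub (hy0 i) (hz0 i))
  rcases eq_or_ne i j with rfl | hij
  · exact le_rfl
  have hsmall : ∀ᶠ ε in 𝓝[>] (0 : ℝ), 0 < ε ∧ ε ≤ y i := Ioc_mem_nhdsGT hi
  have hlim : ∀ k (g : ℝ → ℝ), Continuous g → g 0 = y k → (∀ᶠ ε in 𝓝[>] (0 : ℝ), 0 ≤ g ε) →
      Tendsto (fun ε => c k (g ε)) (𝓝[>] 0) (𝓝 (c k (y k))) := fun k g hg hg0 hpos =>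
    (hcont k (y k) (hy0 k)).tendsto.comp <| tendsto_nhdsWithin_iff.2
      ⟨hg0 ▸ (hg.tendsto 0).mono_left nhdsWithin_le_nhds, hpos⟩
  refine le_of_tendsto_of_tendsto
    (hlim i (fun ε => y i - ε) (by fun_prop) (sub_zero _)
      (hsmall.mono fun ε h => sub_nonneg.2 h.2))
    (hlim j (fun ε => y j + ε) (by fun_prop) (add_zero _)
      (hsmall.mono fun ε h => add_nonneg (hy0 j) h.1.le))
    (hsmall.mono fun ε h => ?_)
  exact cost_le_cost_of_shift (fun k => (hmono k).monotoneOn) hy0 hysum hmin hij h.1 h.2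
end

section
/- Consider a routing game on n ≥ 1 parallel links with continuous, strictly increasing cost functions c_1, …, c_n. For every demand d ≥ 0 there exists a Wardrop equilibrium, i.e. a feasible flow y with y_i ≥ 0, Σ_i y_i = d, such that y_i > 0 implies c_i(y_i) ≤ c_j(y_j) for all j. -/
/-- A minimizer, over the nonnegative flows of demand `d`, of a separable sum of differentiable
functions satisfies the first-order optimality condition. -/
theorem deriv_le_deriv_of_isMinOn_sum {ι : Type*} [Fintype ι] {P P' : ι → ℝ → ℝ}
    (hP : ∀ i x, HasDerivAt (P i) (P' i x) x) {d : ℝ} {y : ι → ℝ}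
    (hy : ∀ i, 0 ≤ y i) (hsum : ∑ i, y i = d)
    (hmin : IsMinOn (fun z => ∑ i, P i (z i)) {z : ι → ℝ | (∀ i, 0 ≤ z i) ∧ ∑ i, z i = d} y)
    (i j : ι) (hi : 0 < y i) : P' i (y i) ≤ P' j (y j) := by
  classical
  set v : ι → ℝ := Pi.single j 1 - Pi.single i 1 with hv
  have hline (k : ι) : HasDerivAt (fun t : ℝ => y k + t * v k) (v k) 0 := by
    simpa using ((hasDerivAt_id (0 : ℝ)).mul_const (v k)).const_add (y k)
  have hderiv : HasDerivAt (fun t : ℝ => ∑ k, P k (y k + t * v k)) (∑ k, P' k (y k) * v k) 0 := by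
    refine HasDerivAt.fun_sum fun k _ => ?_
    have h := hP k (y k + 0 * v k)
    simpa [Function.comp_def] using h.comp (0 : ℝ) (hline k)
  have hval : ∑ k, P' k (y k) * v k = P' j (y j) - P' i (y i) := by
    simp [hv, mul_sub, Finset.sum_sub_distrib, Pi.single_apply]
  rw [hval] at hderiv
  have hslope := (hasDerivWithinAt_iff_tendsto_slope' (s := Set.Ioi (0 : ℝ)) (by simp)).1
    hderiv.hasDerivWithinAt
  refine sub_nonneg.1 (ge_of_tendsto hslope ?_)
  filter_upwards [Ioc_mem_nhdsGT hi] with t ht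
  have hmem : (fun k => y k + t * v k) ∈ {z : ι → ℝ | (∀ i, 0 ≤ z i) ∧ ∑ i, z i = d} := by
    refine ⟨fun k => ?_, ?_⟩
    · have hk := hy k
      have ht0 := ht.1
      have hti := ht.2
      simp only [hv, Pi.sub_apply, Pi.single_apply]
      split_ifs <;> subst_vars <;> linarith
    · simp [hv, Finset.sum_add_distrib, ← Finset.mul_sum, hsum]
  have hle := isMinOn_iff.1 hmin _ hmem
  rw [slope_def_field]
  refine div_nonneg ?_ (by linarith [ht.1])
  simpa using hle

/-- The set of nonnegative flows of demand `d` is compact. -/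
theorem isCompact_nonneg_sum_eq {ι : Type*} [Fintype ι] (d : ℝ) :
    IsCompact {z : ι → ℝ | (∀ i, 0 ≤ z i) ∧ ∑ i, z i = d} := by
  refine (isCompact_Icc (a := (0 : ι → ℝ)) (b := fun _ => d)).of_isClosed_subset ?_ ?_
  · simp only [Set.ofPred_and, Set.ofPred_forall]
    exact (isClosed_iInter fun i => isClosed_le continuous_const (continuous_apply i)).inter
      (isClosed_eq (by fun_prop) continuous_const)
  · rintro z ⟨hz, hs⟩
    exact ⟨hz, fun i => hs ▸ Finset.single_le_sum (fun k _ => hz k) (Finset.mem_univ i)⟩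

/-- For `n ≥ 1` parallel links with continuous, strictly increasing cost
functions, a Wardrop equilibrium exists for every demand `d ≥ 0`. -/
theorem stmt15 {n : ℕ} (hn : 1 ≤ n) (c : Fin n → ℝ → ℝ)
    (hcont : ∀ i, ContinuousOn (c i) (Set.Ici 0))
    (hmono : ∀ i, StrictMonoOn (c i) (Set.Ici 0))
    (d : ℝ) (hd : 0 ≤ d) :
    ∃ y : Fin n → ℝ, IsWardrop n c d y := by
  have hC (i : Fin n) : Continuous fun x => c i (max x 0) :=
    (hcont i).comp_continuous (by fun_prop) fun x => le_max_right x 0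
  have hP (i : Fin n) (x : ℝ) :
      HasDerivAt (fun u => ∫ t in (0 : ℝ)..u, c i (max t 0)) (c i (max x 0)) x :=
    (hC i).integral_hasStrictDerivAt 0 x |>.hasDerivAt
  have hne : {z : Fin n → ℝ | (∀ i, 0 ≤ z i) ∧ ∑ i, z i = d}.Nonempty := by
    refine ⟨Pi.single ⟨0, hn⟩ d, fun i => ?_, by simp⟩
    rw [Pi.single_apply]
    split_ifs <;> simp [hd]
  have hPc (i : Fin n) : Continuous fun u => ∫ t in (0 : ℝ)..u, c i (max t 0) :=
    continuous_iff_continuousAt.2 fun x => (hP i x).continuousAt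
  obtain ⟨y, ⟨hy, hsum⟩, hmin⟩ := (isCompact_nonneg_sum_eq d).exists_isMinOn hne
    (f := fun z : Fin n → ℝ => ∑ i, ∫ t in (0 : ℝ)..(z i), c i (max t 0))
    (continuous_finsetSum _ fun i _ => (hPc i).comp (continuous_apply i)).continuousOn
  refine ⟨y, hy, hsum, fun i j hi => ?_⟩
  simpa [hy] using deriv_le_deriv_of_isMinOn_sum hP hy hsum hmin i j hi
end

section
/- Consider a routing game on n parallel links with continuous, strictly increasing cost functions c_1, …, c_n. Let y* : [0, ∞) → ℝ^n be any function such that for every d ≥ 0, y*(d) is a Wardrop equilibrium for demand d. Then y* is continuous on [0, ∞); that is, the (unique) equilibrium loads depend continuously on the demand. -/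
/-- Equilibrium link loads are monotone in the demand. -/
theorem IsWardrop.mono {n : ℕ} {c : Fin n → ℝ → ℝ}
    (hmono : ∀ i, StrictMonoOn (c i) (Set.Ici 0)) {d d' : ℝ} {y y' : Fin n → ℝ}
    (hy : IsWardrop n c d y) (hy' : IsWardrop n c d' y') (hd : d ≤ d') : y ≤ y' := by
  intro i
  by_contra! hi
  obtain ⟨j, hj⟩ : ∃ j, y j < y' j := by
    by_contra! hle
    have hlt : ∑ k, y' k < ∑ k, y k :=
      Finset.sum_lt_sum (fun k _ => hle k) ⟨i, Finset.mem_univ i, hi⟩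
    linarith [hy.2.1, hy'.2.1]
  have h₁ := hy.2.2 i j ((hy'.1 i).trans_lt hi)
  have h₂ := hmono j (hy.1 j) (hy'.1 j) hj
  have h₃ := hy'.2.2 j i ((hy.1 j).trans_lt hj)
  have h₄ := hmono i (hy'.1 i) (hy.1 i) hi
  linarith

/-- A larger demand changes each equilibrium link load by at most the change in demand. -/
theorem IsWardrop.dist_le_of_le {n : ℕ} {c : Fin n → ℝ → ℝ}
    (hmono : ∀ i, StrictMonoOn (c i) (Set.Ici 0)) {d d' : ℝ} {y y' : Fin n → ℝ}
    (hy : IsWardrop n c d y) (hy' : IsWardrop n c d' y') (hd : d ≤ d') :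
    dist y y' ≤ dist d d' := by
  have hle := hy.mono hmono hy' hd
  refine (dist_pi_le_iff dist_nonneg).2 fun i => ?_
  have hi : y' i - y i ≤ ∑ k, (y' k - y k) :=
    Finset.single_le_sum (f := fun k => y' k - y k)
      (fun k _ => sub_nonneg.2 (hle k)) (Finset.mem_univ i)
  rw [Finset.sum_sub_distrib, hy.2.1, hy'.2.1] at hi
  rwa [dist_comm, dist_comm d, Real.dist_eq, Real.dist_eq,
    abs_of_nonneg (sub_nonneg.2 (hle i)), abs_of_nonneg (sub_nonneg.2 hd)]

/-- For continuous, strictly increasing cost functions, any selection of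
Wardrop equilibria as a function of the demand is continuous on `[0, ∞)`. -/
theorem stmt16 {n : ℕ} (c : Fin n → ℝ → ℝ)
    (hcont : ∀ i, ContinuousOn (c i) (Set.Ici 0))
    (hmono : ∀ i, StrictMonoOn (c i) (Set.Ici 0))
    (ystar : ℝ → Fin n → ℝ)
    (h : ∀ d ≥ (0:ℝ), IsWardrop n c d (ystar d)) :
    ContinuousOn ystar (Set.Ici 0) := by
  refine (LipschitzOnWith.of_dist_le_mul (K := 1) fun d hd d' hd' => ?_).continuousOn
  rw [NNReal.coe_one, one_mul]
  rcases le_total d d' with hle | hle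
  · exact (h d hd).dist_le_of_le hmono (h d' hd') hle
  · rw [dist_comm, dist_comm d]
    exact (h d' hd').dist_le_of_le hmono (h d hd) hle
end
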